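/- Local error of the twisted potential approximation (Lemma 5.5, Fourier form): Let s ≥ 0, 2 ≤ p ≤ ∞, γ_p = 3/2 + 1/p, and ε ∈ (0, 1/4); set a = min{ s + 1/p + 1/4 − ε, 1 } and σ = s + γ_p − ε. There exists a constant C > 0 such that for all τ ∈ (0,1], all ξ̂ : ℤ → ℂ with ‖ξ̂‖_{b̂^{s,p}} < ∞, and all w : ℤ → ℂ with ‖w‖_{h^σ} < ∞, setting E_k = Σ_{k₁+k₂=k} [ M_τ(e^{is(k²−k₂²)}) − M_τ(e^{isk²}) M_τ(e^{−isk₂²}) ] ξ̂_{k₁} w_{k₂} (the sum converging absolutely), one has (Σ_{k∈ℤ} |E_k|²)^{1/2} ≤ C τ^{a} ‖ξ̂‖_{b̂^{s,p}} ‖w‖_{h^σ}. -/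

import Mathlib

open scoped ENNReal

/-- The Japanese bracket `⟨k⟩ = (1 + k²)^{1/2}` of an integer `k`. -/
noncomputable def jbr (k : ℤ) : ℝ := Real.sqrt (1 + (k : ℝ) ^ 2)

/-- The `b̂^{s,p}` norm `|ξ̂_0| + ‖ |k|^s ξ̂_k ‖_{ℓ^p(k≠0)}` of a sequence of Fourier
coefficients, for `1 ≤ p ≤ ∞`. -/
noncomputable def bnorm (s : ℝ) (p : ℝ≥0∞) (ξ : ℤ → ℂ) : ℝ :=
  ‖ξ 0‖ +
    if p = ∞ then ⨆ k : ℤ, (if k = 0 then 0 else (|k| : ℝ) ^ s * ‖ξ k‖)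
    else (∑' k : ℤ, (if k = 0 then (0 : ℝ) else ((|k| : ℝ) ^ s * ‖ξ k‖) ^ p.toReal)) ^
      (1 / p.toReal)

/-- The average `M_τ(e^{isα}) = (1/τ) ∫₀^τ e^{isα} ds` of a complex exponential. -/
noncomputable def avgExp (τ α : ℝ) : ℂ :=
  (τ : ℂ)⁻¹ * ∫ s in (0 : ℝ)..τ, Complex.exp (Complex.I * (s : ℂ) * (α : ℂ))

lemma one_le_jbr (k : ℤ) : 1 ≤ jbr k := by
  unfold jbr
  rw [Real.one_le_sqrt]
  nlinarith [sq_nonneg (k : ℝ)]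

lemma jbr_pos (k : ℤ) : 0 < jbr k := zero_lt_one.trans_le (one_le_jbr k)

lemma jbr_sq (k : ℤ) : jbr k ^ 2 = 1 + (k : ℝ) ^ 2 :=
  Real.sq_sqrt (by positivity)

lemma abs_le_jbr (k : ℤ) : |(k : ℝ)| ≤ jbr k :=
  abs_le_of_sq_le_sq (by rw [jbr_sq]; linarith) (jbr_pos k).le

lemma jbr_le_two_mul_abs {k : ℤ} (hk : k ≠ 0) : jbr k ≤ 2 * |(k : ℝ)| := by
  have h1 : (1 : ℝ) ≤ |(k : ℝ)| := by exact_mod_cast Int.one_le_abs hk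
  refine Real.sqrt_le_iff.mpr ⟨by positivity, ?_⟩
  rw [← sq_abs (k : ℝ)]
  nlinarith

lemma summable_jbr_rpow_neg {b : ℝ} (hb : 1 < b) : Summable fun k : ℤ => jbr k ^ (-b) := by
  refine ((Real.summable_abs_int_rpow hb).add
    (summable_of_hasFiniteSupport (f := fun k : ℤ => if k = 0 then (1 : ℝ) else 0)
      ((Set.finite_singleton 0).subset ?_))).of_nonneg_of_le
      (fun k => Real.rpow_nonneg (jbr_pos k).le _) fun k => ?_
  · intro k hk
    by_contra h
    simp_all
  · by_cases hk : k = 0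
    · simp [hk, jbr, Real.zero_rpow (by linarith : -b ≠ 0)]
    · have h1 : (0 : ℝ) < |(k : ℝ)| := by positivity
      simpa [hk] using Real.rpow_le_rpow_of_nonpos h1 (abs_le_jbr k) (by linarith : -b ≤ 0)

lemma avgExp_zero {τ : ℝ} (hτ : 0 < τ) : avgExp τ 0 = 1 := by
  have : (τ : ℂ) ≠ 0 := by exact_mod_cast hτ.ne'
  simp [avgExp, this]

lemma norm_exp_I_mul_ofReal_mul_ofReal (s α : ℝ) :
    ‖Complex.exp (Complex.I * (s : ℂ) * (α : ℂ))‖ = 1 := by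
  rw [mul_assoc, ← Complex.ofReal_mul, Complex.norm_exp_I_mul_ofReal]

lemma norm_avgExp_le_one {τ : ℝ} (hτ : 0 < τ) (α : ℝ) : ‖avgExp τ α‖ ≤ 1 := by
  have h := intervalIntegral.norm_integral_le_of_norm_le_const (a := 0) (b := τ) (C := 1)
    (f := fun s : ℝ => Complex.exp (Complex.I * (s : ℂ) * (α : ℂ)))
    (fun s _ => (norm_exp_I_mul_ofReal_mul_ofReal s α).le)
  rw [sub_zero, one_mul, abs_of_pos hτ] at h
  rw [avgExp, norm_mul, norm_inv, Complex.norm_real, Real.norm_of_nonneg hτ.le,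
    inv_mul_le_iff₀ hτ, mul_one]
  exact h

lemma I_mul_mul_avgExp {τ : ℝ} (hτ : 0 < τ) (α : ℝ) :
    Complex.I * τ * α * avgExp τ α = Complex.exp (Complex.I * τ * α) - 1 := by
  have hτ' : (τ : ℂ) ≠ 0 := by exact_mod_cast hτ.ne'
  by_cases hα : α = 0
  · simp [hα]
  have hα' : Complex.I * (α : ℂ) ≠ 0 := by simpa using hα
  have h := integral_exp_mul_complex (a := 0) (b := τ) hα'
  have e : avgExp τ α = (τ : ℂ)⁻¹ * ∫ x in (0 : ℝ)..τ, Complex.exp (Complex.I * α * x) := by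
    simp only [avgExp]
    congr 2
    ext x
    ring_nf
  rw [e, h]
  have hα'' : (α : ℂ) ≠ 0 := by exact_mod_cast hα
  have hI := Complex.I_ne_zero
  field_simp
  simp

lemma norm_exp_sub_exp_le (s α β : ℝ) :
    ‖Complex.exp (Complex.I * (s : ℂ) * (α : ℂ)) - Complex.exp (Complex.I * (s : ℂ) * (β : ℂ))‖
      ≤ |s| * |α - β| := by
  have e : Complex.exp (Complex.I * (s : ℂ) * (α : ℂ)) - Complex.exp (Complex.I * (s : ℂ) * (β : ℂ))
      = Complex.exp (Complex.I * (s : ℂ) * (β : ℂ)) *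
        (Complex.exp (Complex.I * ((s * (α - β) : ℝ) : ℂ)) - 1) := by
    rw [mul_sub, ← Complex.exp_add]
    push_cast
    ring_nf
  rw [e, norm_mul, norm_exp_I_mul_ofReal_mul_ofReal, one_mul]
  refine (Real.norm_exp_I_mul_ofReal_sub_one_le).trans ?_
  rw [Real.norm_eq_abs, abs_mul]

lemma norm_avgExp_sub_avgExp_le {τ : ℝ} (hτ : 0 < τ) (α β : ℝ) :
    ‖avgExp τ α - avgExp τ β‖ ≤ τ * |α - β| := by
  have hi : ∀ γ : ℝ, IntervalIntegrable
      (fun s : ℝ => Complex.exp (Complex.I * (s : ℂ) * (γ : ℂ))) MeasureTheory.volume 0 τ :=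
    fun γ => Continuous.intervalIntegrable (by fun_prop) _ _
  have h := intervalIntegral.norm_integral_le_of_norm_le_const (a := 0) (b := τ)
    (C := τ * |α - β|)
    (f := fun s : ℝ => Complex.exp (Complex.I * (s : ℂ) * (α : ℂ)) -
      Complex.exp (Complex.I * (s : ℂ) * (β : ℂ))) (fun s hs => by
        rw [Set.uIoc_of_le hτ.le] at hs
        refine (norm_exp_sub_exp_le s α β).trans ?_
        rw [abs_of_pos hs.1]
        gcongr
        exact hs.2)
  rw [intervalIntegral.integral_sub (hi α) (hi β), sub_zero, abs_of_pos hτ] at h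
  rw [avgExp, avgExp, ← mul_sub, norm_mul, norm_inv, Complex.norm_real,
    Real.norm_of_nonneg hτ.le, inv_mul_le_iff₀ hτ, mul_comm τ]
  exact h

/-- The twisted potential kernel, i.e. the covariance of `e^{isα}` and `e^{-isβ}` on `[0, τ]`. -/
noncomputable def avgCov (τ α β : ℝ) : ℂ :=
  avgExp τ (α - β) - avgExp τ α * avgExp τ (-β)

lemma norm_avgCov_le_two {τ : ℝ} (hτ : 0 < τ) (α β : ℝ) : ‖avgCov τ α β‖ ≤ 2 := by
  refine (norm_sub_le _ _).trans ?_
  rw [norm_mul]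
  nlinarith [norm_avgExp_le_one hτ (α - β), norm_avgExp_le_one hτ α, norm_avgExp_le_one hτ (-β),
    norm_nonneg (avgExp τ α), norm_nonneg (avgExp τ (-β))]

lemma norm_avgExp_neg_sub_one_le {τ β : ℝ} (hτ : 0 < τ) (hβ : 0 ≤ β) :
    ‖avgExp τ (-β) - 1‖ ≤ τ * β := by
  simpa [avgExp_zero hτ, abs_of_nonneg hβ] using norm_avgExp_sub_avgExp_le hτ (-β) 0

lemma norm_avgCov_le {τ β : ℝ} (hτ : 0 < τ) (α : ℝ) (hβ : 0 ≤ β) :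
    ‖avgCov τ α β‖ ≤ 2 * (τ * β) := by
  have e : avgCov τ α β =
      (avgExp τ (α - β) - avgExp τ α) - avgExp τ α * (avgExp τ (-β) - 1) := by
    rw [avgCov]; ring
  have h1 := norm_avgExp_sub_avgExp_le hτ (α - β) α
  rw [show α - β - α = -β by ring, abs_neg, abs_of_nonneg hβ] at h1
  have h2 := mul_le_mul (norm_avgExp_le_one hτ α) (norm_avgExp_neg_sub_one_le hτ hβ)
    (norm_nonneg _) zero_le_one
  rw [← norm_mul] at h2
  rw [e]
  linarith [norm_sub_le (avgExp τ (α - β) - avgExp τ α) (avgExp τ α * (avgExp τ (-β) - 1))]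

lemma mul_norm_avgCov_le {τ α β : ℝ} (hτ : 0 < τ) (hα : 0 ≤ α) (hβ : 0 ≤ β) :
    τ * α * ‖avgCov τ α β‖ ≤ 4 * (τ * β) := by
  have e : Complex.I * τ * α * avgCov τ α β =
      (Complex.exp (Complex.I * τ * (α - β : ℝ)) - Complex.exp (Complex.I * τ * α))
        + Complex.I * τ * β * avgExp τ (α - β)
        - (Complex.exp (Complex.I * τ * α) - 1) * (avgExp τ (-β) - 1) := by
    have h1 := I_mul_mul_avgExp hτ (α - β)
    have h2 := I_mul_mul_avgExp hτ α
    rw [avgCov]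
    push_cast at h1 ⊢
    linear_combination h1 - avgExp τ (-β) * h2
  have n1 : ‖Complex.I * τ * α * avgCov τ α β‖ = τ * α * ‖avgCov τ α β‖ := by
    simp [abs_of_pos hτ, abs_of_nonneg hα]
  have n2 := norm_exp_sub_exp_le τ (α - β) α
  rw [show α - β - α = -β by ring, abs_neg, abs_of_nonneg hβ, abs_of_pos hτ] at n2
  have n3 : ‖Complex.I * τ * β * avgExp τ (α - β)‖ ≤ τ * β := by
    have : ‖Complex.I * τ * β * avgExp τ (α - β)‖ = τ * β * ‖avgExp τ (α - β)‖ := by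
      simp [abs_of_pos hτ, abs_of_nonneg hβ]
    rw [this]
    exact mul_le_of_le_one_right (by positivity) (norm_avgExp_le_one hτ _)
  have n4 : ‖Complex.exp (Complex.I * τ * α) - 1‖ ≤ 2 := by
    refine (norm_sub_le _ _).trans ?_
    rw [norm_exp_I_mul_ofReal_mul_ofReal, norm_one]
    norm_num
  have n5 := mul_le_mul n4 (norm_avgExp_neg_sub_one_le hτ hβ) (norm_nonneg _) zero_le_two
  rw [← norm_mul] at n5
  rw [← n1, e]
  refine (norm_sub_le _ _).trans ((add_le_add (norm_add_le _ _) le_rfl).trans ?_)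
  linarith

lemma two_mul_mul_le_sq_add_sq (x y : ℝ≥0∞) : 2 * (x * y) ≤ x ^ 2 + y ^ 2 := by
  rcases eq_or_ne x ∞ with rfl | hx
  · simp
  rcases eq_or_ne y ∞ with rfl | hy
  · simp
  lift x to NNReal using hx
  lift y to NNReal using hy
  norm_cast
  rw [← mul_assoc]
  exact two_mul_le_add_sq x y

lemma ENNReal.tsum_sq_le_tsum_mul_tsum {ι : Type*} {r f g : ι → ℝ≥0∞}
    (h : ∀ i j, 2 * (r i * r j) ≤ f i * g j + f j * g i) :
    (∑' i, r i) ^ 2 ≤ (∑' i, f i) * ∑' i, g i := by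
  have e : ∀ u v : ι → ℝ≥0∞, (∑' i, u i) * ∑' j, v j = ∑' i, ∑' j, u i * v j := by
    intro u v
    rw [← ENNReal.tsum_mul_right]
    simp_rw [ENNReal.tsum_mul_left]
  have e' : (∑' i, f i) * ∑' i, g i = ∑' i, ∑' j, f j * g i := by
    rw [e, ENNReal.tsum_comm]
  have key : 2 * (∑' i, r i) ^ 2 ≤ 2 * ((∑' i, f i) * ∑' i, g i) := by
    calc 2 * (∑' i, r i) ^ 2 = ∑' i, ∑' j, 2 * (r i * r j) := by
          simp_rw [ENNReal.tsum_mul_left, sq, ENNReal.tsum_mul_right]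
      _ ≤ ∑' i, ∑' j, (f i * g j + f j * g i) :=
          ENNReal.tsum_le_tsum fun i => ENNReal.tsum_le_tsum fun j => h i j
      _ = (∑' i, f i) * ∑' i, g i + (∑' i, f i) * ∑' i, g i := by
          simp_rw [ENNReal.tsum_add]
          rw [← e, ← e']
      _ = 2 * ((∑' i, f i) * ∑' i, g i) := (two_mul _).symm
  exact (ENNReal.mul_le_mul_iff_right two_ne_zero ENNReal.ofNat_ne_top).mp key

/-- The Cauchy-Schwarz inequality for sums of extended nonnegative reals. -/
lemma ENNReal.tsum_mul_sq_le {ι : Type*} (f g : ι → ℝ≥0∞) :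
    (∑' i, f i * g i) ^ 2 ≤ (∑' i, f i ^ 2) * ∑' i, g i ^ 2 := by
  refine ENNReal.tsum_sq_le_tsum_mul_tsum fun i j => ?_
  calc 2 * (f i * g i * (f j * g j)) = 2 * (f i * g j * (f j * g i)) := by ring
    _ ≤ (f i * g j) ^ 2 + (f j * g i) ^ 2 := two_mul_mul_le_sq_add_sq _ _
    _ = f i ^ 2 * g j ^ 2 + f j ^ 2 * g i ^ 2 := by ring

/-- Young's convolution inequality `ℓ¹ * ℓ² ⊆ ℓ²` on `ℤ`. -/
lemma ENNReal.tsum_conv_sq_le (g f : ℤ → ℝ≥0∞) :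
    ∑' k, (∑' j, g j * f (k - j)) ^ 2 ≤ (∑' j, g j) ^ 2 * ∑' k, f k ^ 2 := by
  calc ∑' k, (∑' j, g j * f (k - j)) ^ 2
      ≤ ∑' k, (∑' j, g j) * ∑' j, g j * f (k - j) ^ 2 := by
        refine ENNReal.tsum_le_tsum fun k => ENNReal.tsum_sq_le_tsum_mul_tsum fun i j => ?_
        calc 2 * (g i * f (k - i) * (g j * f (k - j)))
            = g i * g j * (2 * (f (k - i) * f (k - j))) := by ring
          _ ≤ g i * g j * (f (k - i) ^ 2 + f (k - j) ^ 2) := by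
            gcongr
            exact two_mul_mul_le_sq_add_sq _ _
          _ = g i * (g j * f (k - j) ^ 2) + g j * (g i * f (k - i) ^ 2) := by ring
    _ = (∑' j, g j) * ∑' j, g j * ∑' k, f (k - j) ^ 2 := by
        rw [ENNReal.tsum_mul_left, ENNReal.tsum_comm]
        simp_rw [ENNReal.tsum_mul_left]
    _ = (∑' j, g j) ^ 2 * ∑' k, f k ^ 2 := by
        have : ∀ j : ℤ, ∑' k, f (k - j) ^ 2 = ∑' k, f k ^ 2 := fun j =>
          (Equiv.subRight j).tsum_eq fun k => f k ^ 2
        simp_rw [this, ENNReal.tsum_mul_right]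
        rw [sq, mul_assoc]

lemma ENNReal.tsum_weighted_conv_sq_le (μ x y : ℤ → ℝ≥0∞) :
    ∑' k, (∑' j, (μ j + μ (k - j)) * x j * y (k - j)) ^ 2 ≤
      4 * (∑' k, μ k ^ 2) * (∑' k, x k ^ 2) * ∑' k, y k ^ 2 := by
  have e : ∀ k, ∑' j, (μ j + μ (k - j)) * x j * y (k - j) =
      (∑' j, μ j * x j * y (k - j)) + ∑' j, μ j * y j * x (k - j) := by
    intro k
    have h : ∑' j, μ j * y j * x (k - j) = ∑' j, μ (k - j) * y (k - j) * x j := by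
      simpa using ((Equiv.subLeft k).tsum_eq fun j => μ j * y j * x (k - j)).symm
    rw [h, ← ENNReal.tsum_add]
    exact tsum_congr fun j => by ring
  have hsq : ∀ u v : ℝ≥0∞, (u + v) ^ 2 ≤ 2 * (u ^ 2 + v ^ 2) := fun u v => by
    calc (u + v) ^ 2 = u ^ 2 + v ^ 2 + 2 * (u * v) := by ring
      _ ≤ u ^ 2 + v ^ 2 + (u ^ 2 + v ^ 2) := by
        gcongr
        exact two_mul_mul_le_sq_add_sq _ _
      _ = 2 * (u ^ 2 + v ^ 2) := (two_mul _).symm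
  have h1 := (ENNReal.tsum_conv_sq_le (fun j => μ j * x j) y).trans
    (mul_le_mul_left (ENNReal.tsum_mul_sq_le μ x) _)
  have h2 := (ENNReal.tsum_conv_sq_le (fun j => μ j * y j) x).trans
    (mul_le_mul_left (ENNReal.tsum_mul_sq_le μ y) _)
  calc _ ≤ ∑' k, 2 * ((∑' j, μ j * x j * y (k - j)) ^ 2 +
        (∑' j, μ j * y j * x (k - j)) ^ 2) := by
        refine ENNReal.tsum_le_tsum fun k => ?_
        rw [e]
        exact hsq _ _
    _ = 2 * (∑' k, (∑' j, μ j * x j * y (k - j)) ^ 2 +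
        ∑' k, (∑' j, μ j * y j * x (k - j)) ^ 2) := by
        rw [ENNReal.tsum_mul_left, ENNReal.tsum_add]
    _ ≤ 2 * ((∑' k, μ k ^ 2) * (∑' k, x k ^ 2) * (∑' k, y k ^ 2) +
        (∑' k, μ k ^ 2) * (∑' k, y k ^ 2) * (∑' k, x k ^ 2)) := by
        gcongr
    _ = _ := by ring

lemma le_mul_rpow_of_le {n X a C : ℝ} (hX : 0 < X) (ha0 : 0 ≤ a) (ha1 : a ≤ 1) (hC : 0 ≤ C)
    (h1 : n ≤ C) (h2 : n ≤ C * X) : n ≤ C * X ^ a := by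
  rcases le_total X 1 with h | h
  · refine h2.trans (mul_le_mul_of_nonneg_left ?_ hC)
    simpa using Real.rpow_le_rpow_of_exponent_ge hX h ha1
  · refine h1.trans (le_mul_of_one_le_right hC ?_)
    exact Real.one_le_rpow h ha0

lemma norm_avgCov_le_rpow {τ a : ℝ} (hτ : 0 < τ) (ha0 : 0 ≤ a) (ha1 : a ≤ 1) (k m : ℤ) :
    ‖avgCov τ ((k : ℝ) ^ 2) ((m : ℝ) ^ 2)‖ ≤ 2 * (τ ^ a * jbr m ^ (2 * a)) := by
  have hJ := jbr_pos m
  have h := le_mul_rpow_of_le (n := ‖avgCov τ ((k : ℝ) ^ 2) ((m : ℝ) ^ 2)‖)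
    (X := τ * jbr m ^ 2) (by positivity) ha0 ha1 zero_le_two (norm_avgCov_le_two hτ _ _)
    ((norm_avgCov_le hτ _ (sq_nonneg _)).trans (by rw [jbr_sq]; gcongr; linarith))
  rwa [Real.mul_rpow hτ.le (by positivity), ← Real.rpow_natCast (jbr m) 2,
    ← Real.rpow_mul hJ.le] at h

lemma norm_avgCov_le_rpow_mul_rpow {τ a : ℝ} (hτ : 0 < τ) (ha0 : 0 ≤ a)
    (ha1 : a ≤ 1) (k j : ℤ) :
    ‖avgCov τ ((k : ℝ) ^ 2) (((k - j : ℤ) : ℝ) ^ 2)‖ ≤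
      12 * (τ ^ a * jbr (k - j) ^ (2 : ℝ) * jbr j ^ (2 * a - 2)) := by
  have hJ := jbr_pos j
  have hM := jbr_pos (k - j)
  have h0 := norm_nonneg (avgCov τ ((k : ℝ) ^ 2) (((k - j : ℤ) : ℝ) ^ 2))
  have h1 := norm_avgCov_le hτ ((k : ℝ) ^ 2) (sq_nonneg (((k - j : ℤ) : ℝ)))
  have h2 := norm_avgCov_le_two hτ ((k : ℝ) ^ 2) (((k - j : ℤ) : ℝ) ^ 2)
  have h3 := mul_norm_avgCov_le hτ (sq_nonneg (k : ℝ)) (sq_nonneg (((k - j : ℤ) : ℝ)))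
  set n := ‖avgCov τ ((k : ℝ) ^ 2) (((k - j : ℤ) : ℝ) ^ 2)‖
  have hMs := jbr_sq (k - j)
  have hJs : jbr j ^ 2 ≤ 2 * (k : ℝ) ^ 2 + 2 * jbr (k - j) ^ 2 := by
    rw [jbr_sq, jbr_sq]
    push_cast
    nlinarith [sq_nonneg (2 * (k : ℝ) - j)]
  have hZ : 0 < τ * jbr j ^ 2 := by positivity
  have hb : n * (τ * jbr j ^ 2) ≤ 12 * (τ * jbr (k - j) ^ 2) := by
    calc n * (τ * jbr j ^ 2) ≤ n * (τ * (2 * (k : ℝ) ^ 2 + 2 * jbr (k - j) ^ 2)) := by gcongr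
      _ = 2 * (τ * (k : ℝ) ^ 2 * n) + 2 * (τ * jbr (k - j) ^ 2) * n := by ring
      _ ≤ 2 * (4 * (τ * ((k - j : ℤ) : ℝ) ^ 2)) + 2 * (τ * jbr (k - j) ^ 2) * 2 := by gcongr
      _ ≤ 12 * (τ * jbr (k - j) ^ 2) := by rw [hMs]; nlinarith
  have hc : n ≤ 12 * (τ * jbr (k - j) ^ 2) := by
    refine h1.trans ?_
    rw [hMs]
    nlinarith [mul_nonneg hτ.le (sq_nonneg (((k - j : ℤ) : ℝ)))]
  have key := le_mul_rpow_of_le (n := n * (τ * jbr j ^ 2)) (X := τ * jbr j ^ 2) hZ ha0 ha1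
    (C := 12 * (τ * jbr (k - j) ^ 2)) (by positivity) hb
    (mul_le_mul_of_nonneg_right hc hZ.le)
  rw [← le_div_iff₀ hZ] at key
  refine key.trans_eq ?_
  rw [Real.mul_rpow hτ.le (by positivity), ← Real.rpow_natCast (jbr j) 2,
    ← Real.rpow_natCast (jbr (k - j)) 2, ← Real.rpow_mul hJ.le, Real.rpow_sub hJ]
  push_cast
  field_simp

lemma norm_avgCov_le_weights {τ r ε : ℝ} (hτ : 0 < τ) (hr : 0 ≤ r) (hε0 : 0 < ε)
    (hε1 : ε < 1 / 4) (k j : ℤ) :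
    ‖avgCov τ ((k : ℝ) ^ 2) (((k - j : ℤ) : ℝ) ^ 2)‖ ≤
      12 * τ ^ min (r + 1 / 4 - ε) 1 *
        ((jbr j ^ (-(1 / 2 + ε / 2)) + jbr (k - j) ^ (-(1 / 2 + ε / 2))) *
          jbr j ^ (r - 1 / 2 - ε / 2) * jbr (k - j) ^ (r + 3 / 2 - ε)) := by
  set a := min (r + 1 / 4 - ε) 1 with ha
  have har : a ≤ r + 1 / 4 - ε := min_le_left _ _
  have ha1 : a ≤ 1 := min_le_right _ _
  have ha0 : 0 ≤ a := le_min (by linarith) zero_le_one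
  have hJ := jbr_pos j
  have hM := jbr_pos (k - j)
  have hJ1 := one_le_jbr j
  have hM1 := one_le_jbr (k - j)
  have e : (jbr j ^ (-(1 / 2 + ε / 2)) + jbr (k - j) ^ (-(1 / 2 + ε / 2))) *
      jbr j ^ (r - 1 / 2 - ε / 2) * jbr (k - j) ^ (r + 3 / 2 - ε) =
      jbr j ^ (r - 1 - ε) * jbr (k - j) ^ (r + 3 / 2 - ε) +
      jbr j ^ (r - 1 / 2 - ε / 2) * jbr (k - j) ^ (r + 1 - 3 * ε / 2) := by
    rw [show r - 1 - ε = -(1 / 2 + ε / 2) + (r - 1 / 2 - ε / 2) by ring, Real.rpow_add hJ,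
      show r + 1 - 3 * ε / 2 = -(1 / 2 + ε / 2) + (r + 3 / 2 - ε) by ring, Real.rpow_add hM]
    ring
  rw [e]
  rcases le_total (jbr j) (jbr (k - j)) with h | h
  · have h1 := norm_avgCov_le_rpow hτ ha0 ha1 k (k - j)
    have h2 : jbr (k - j) ^ (2 * a) ≤
        jbr j ^ (r - 1 - ε) * jbr (k - j) ^ (r + 3 / 2 - ε) := by
      rw [show 2 * a = (2 * a - (r + 3 / 2 - ε)) + (r + 3 / 2 - ε) by ring, Real.rpow_add hM]
      gcongr
      exact (Real.rpow_le_rpow_of_nonpos hJ h (by linarith)).trans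
        (Real.rpow_le_rpow_of_exponent_le hJ1 (by linarith))
    calc _ ≤ _ := h1
      _ ≤ 12 * (τ ^ a * jbr (k - j) ^ (2 * a)) := by gcongr; norm_num
      _ ≤ 12 * (τ ^ a * (jbr j ^ (r - 1 - ε) * jbr (k - j) ^ (r + 3 / 2 - ε) +
          jbr j ^ (r - 1 / 2 - ε / 2) * jbr (k - j) ^ (r + 1 - 3 * ε / 2))) := by
          gcongr
          exact h2.trans (le_add_of_nonneg_right (by positivity))
      _ = _ := by ring
  · have h1 := norm_avgCov_le_rpow_mul_rpow hτ ha0 ha1 k j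
    have h2 : jbr (k - j) ^ (2 : ℝ) * jbr j ^ (2 * a - 2) ≤
        jbr j ^ (r - 1 / 2 - ε / 2) * jbr (k - j) ^ (r + 1 - 3 * ε / 2) := by
      have h3 : jbr (k - j) ^ (1 - r + 3 * ε / 2) ≤ jbr j ^ (r + 3 / 2 - ε / 2 - 2 * a) := by
        calc jbr (k - j) ^ (1 - r + 3 * ε / 2) ≤ jbr (k - j) ^ (r + 3 / 2 - ε / 2 - 2 * a) :=
              Real.rpow_le_rpow_of_exponent_le hM1 (by linarith)
          _ ≤ _ := Real.rpow_le_rpow hM.le h (by linarith)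
      have e1 : jbr (k - j) ^ (2 : ℝ) =
          jbr (k - j) ^ (1 - r + 3 * ε / 2) * jbr (k - j) ^ (r + 1 - 3 * ε / 2) := by
        rw [← Real.rpow_add hM]; ring_nf
      have e2 : jbr j ^ (r - 1 / 2 - ε / 2) =
          jbr j ^ (r + 3 / 2 - ε / 2 - 2 * a) * jbr j ^ (2 * a - 2) := by
        rw [← Real.rpow_add hJ]; ring_nf
      rw [e1, e2]
      calc _ = jbr (k - j) ^ (1 - r + 3 * ε / 2) *
            (jbr (k - j) ^ (r + 1 - 3 * ε / 2) * jbr j ^ (2 * a - 2)) := by ring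
        _ ≤ jbr j ^ (r + 3 / 2 - ε / 2 - 2 * a) *
            (jbr (k - j) ^ (r + 1 - 3 * ε / 2) * jbr j ^ (2 * a - 2)) := by gcongr
        _ = _ := by ring
    calc _ ≤ _ := h1
      _ = 12 * (τ ^ a * (jbr (k - j) ^ (2 : ℝ) * jbr j ^ (2 * a - 2))) := by ring
      _ ≤ 12 * (τ ^ a * (jbr j ^ (r - 1 - ε) * jbr (k - j) ^ (r + 3 / 2 - ε) +
          jbr j ^ (r - 1 / 2 - ε / 2) * jbr (k - j) ^ (r + 1 - 3 * ε / 2))) := by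
          gcongr
          exact h2.trans (le_add_of_nonneg_left (by positivity))
      _ = _ := by ring

lemma weighted_sq_le_sup_bound {ι : Type*} {v η : ι → ℝ} {N : ℝ} (hv : Summable v)
    (hv0 : ∀ k, 0 ≤ v k) (hη : ∀ k, 0 ≤ η k) (hN : ∀ k, η k ≤ N) :
    Summable (fun k => v k * η k ^ 2) ∧ ∑' k, v k * η k ^ 2 ≤ (1 + ∑' k, v k) * N ^ 2 := by
  have h : ∀ k, v k * η k ^ 2 ≤ v k * N ^ 2 := fun k =>
    mul_le_mul_of_nonneg_left (pow_le_pow_left₀ (hη k) (hN k) 2) (hv0 k)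
  have hs : Summable fun k => v k * η k ^ 2 :=
    (hv.mul_right (N ^ 2)).of_nonneg_of_le (fun k => mul_nonneg (hv0 k) (sq_nonneg _)) h
  refine ⟨hs, (hs.tsum_le_tsum h (hv.mul_right _)).trans ?_⟩
  rw [tsum_mul_right]
  nlinarith [sq_nonneg N]

/-- Hölder's inequality for `ℓ^{q/2}` against its dual exponent, in a form that includes `q = 2`. -/
lemma weighted_sq_le_rpow_sum {ι : Type*} {v η : ι → ℝ} {q : ℝ} (hq : 2 ≤ q) (hv : Summable v)
    (hv0 : ∀ k, 0 ≤ v k) (hη : ∀ k, 0 ≤ η k) (hs : Summable fun k => η k ^ q) :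
    Summable (fun k => v k ^ (1 - 2 / q) * η k ^ 2) ∧
      ∑' k, v k ^ (1 - 2 / q) * η k ^ 2 ≤
        (1 + ∑' k, v k) * ((∑' k, η k ^ q) ^ (1 / q)) ^ 2 := by
  have hq0 : 0 < q := by linarith
  have hS0 : 0 ≤ ∑' k, η k ^ q := tsum_nonneg fun k => Real.rpow_nonneg (hη k) _
  set N := (∑' k, η k ^ q) ^ (1 / q) with hN
  have hNq : N ^ q = ∑' k, η k ^ q := by
    rw [hN, ← Real.rpow_mul hS0, one_div_mul_cancel hq0.ne', Real.rpow_one]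
  have hle : ∀ k, η k ≤ N := fun k => by
    rw [hN, one_div, Real.le_rpow_inv_iff_of_pos (hη k) hS0 hq0]
    exact hs.le_tsum k fun j _ => Real.rpow_nonneg (hη j) _
  rcases (Real.rpow_nonneg hS0 (1 / q)).eq_or_lt with h0 | h0
  · have : ∀ k, η k = 0 := fun k => le_antisymm ((hle k).trans_eq h0.symm) (hη k)
    simp only [this]
    have hV : 0 ≤ ∑' k, v k := tsum_nonneg hv0
    refine ⟨by simp, ?_⟩
    simp only [ne_eq, OfNat.ofNat_ne_zero, not_false_eq_true, zero_pow, mul_zero, tsum_zero]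
    positivity
  rw [← hN] at h0
  have h : ∀ k, v k ^ (1 - 2 / q) * η k ^ 2 ≤ N ^ 2 * (η k ^ q / N ^ q + v k) := by
    intro k
    have hq1 : 2 / q ≤ 1 := (div_le_one hq0).mpr hq
    have hq2 : 0 ≤ 2 / q := by positivity
    have hd : 0 ≤ η k / N := div_nonneg (hη k) h0.le
    have h1 := Real.geom_mean_le_arith_mean2_weighted hq2 (sub_nonneg.mpr hq1)
      (Real.rpow_nonneg hd q) (hv0 k) (by ring)
    rw [← Real.rpow_mul hd, mul_div_cancel₀ _ hq0.ne', Real.rpow_two,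
      Real.div_rpow (hη k) h0.le] at h1
    have h2 : 0 ≤ η k ^ q / N ^ q :=
      div_nonneg (Real.rpow_nonneg (hη k) _) (Real.rpow_nonneg h0.le _)
    have h3 : (η k / N) ^ 2 * v k ^ (1 - 2 / q) ≤ η k ^ q / N ^ q + v k :=
      h1.trans (add_le_add (mul_le_of_le_one_left h2 hq1)
        (mul_le_of_le_one_left (hv0 k) (by linarith)))
    calc v k ^ (1 - 2 / q) * η k ^ 2 = N ^ 2 * ((η k / N) ^ 2 * v k ^ (1 - 2 / q)) := by
          field_simp
      _ ≤ _ := mul_le_mul_of_nonneg_left h3 (sq_nonneg _)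
  have hg : Summable fun k => N ^ 2 * (η k ^ q / N ^ q + v k) :=
    ((hs.div_const _).add hv).mul_left _
  have hf : Summable fun k => v k ^ (1 - 2 / q) * η k ^ 2 :=
    hg.of_nonneg_of_le (fun k => mul_nonneg (Real.rpow_nonneg (hv0 k) _) (sq_nonneg _)) h
  refine ⟨hf, (hf.tsum_le_tsum h hg).trans_eq ?_⟩
  rw [tsum_mul_left, (hs.div_const _).tsum_add hv, tsum_div_const, hNq, div_self]
  · ring
  · rw [← hNq]
    exact (Real.rpow_pos_of_pos h0 q).ne'

/-- The embedding of `b̂^{s,p}` into `h^{s + 1/p - 1/2 - ε/2}` for `2 ≤ p`. -/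
lemma exists_weighted_sq_le_bnorm_sq {s : ℝ} (hs : 0 ≤ s) {p : ℝ≥0∞} (hp : 2 ≤ p) {ε : ℝ}
    (hε : 0 < ε) :
    ∃ C ≥ 0, ∀ ξ : ℤ → ℂ,
      Memℓp (fun k : ℤ => if k = 0 then (0 : ℝ) else (|k| : ℝ) ^ s * ‖ξ k‖) p →
      Summable (fun k => (jbr k ^ (s + (1 / p).toReal - 1 / 2 - ε / 2) * ‖ξ k‖) ^ 2) ∧
        ∑' k, (jbr k ^ (s + (1 / p).toReal - 1 / 2 - ε / 2) * ‖ξ k‖) ^ 2 ≤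
          C * bnorm s p ξ ^ 2 := by
  have hv := summable_jbr_rpow_neg (b := 1 + ε) (by linarith)
  have hv0 : ∀ k : ℤ, 0 ≤ jbr k ^ (-(1 + ε)) := fun k => Real.rpow_nonneg (jbr_pos k).le _
  set V := ∑' k : ℤ, jbr k ^ (-(1 + ε)) with hV
  have hV0 : 0 ≤ V := tsum_nonneg hv0
  refine ⟨1 + 2 ^ (2 * s) * (1 + V), by positivity, fun ξ hξ => ?_⟩
  set η : ℤ → ℝ := fun k => if k = 0 then (0 : ℝ) else (|k| : ℝ) ^ s * ‖ξ k‖ with hη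
  have hη0 : ∀ k, 0 ≤ η k := fun k => by
    simp only [hη]
    split_ifs <;> positivity
  obtain ⟨θ, N, hb, hN, hθ, hsum, hle⟩ : ∃ θ N : ℝ, bnorm s p ξ = ‖ξ 0‖ + N ∧ 0 ≤ N ∧
      2 * (1 / p).toReal - 1 - ε ≤ -(1 + ε) * θ ∧
      Summable (fun k => (jbr k ^ (-(1 + ε))) ^ θ * η k ^ 2) ∧
      ∑' k, (jbr k ^ (-(1 + ε))) ^ θ * η k ^ 2 ≤ (1 + V) * N ^ 2 := by
    by_cases hp' : p = ∞
    · subst hp'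
      have hbd := hξ.bddAbove
      have hN : ∀ k, η k ≤ ⨆ k, η k := fun k => by
        refine le_ciSup (f := η) ?_ k
        simpa only [Real.norm_of_nonneg (hη0 _)] using hbd
      refine ⟨1, ⨆ k, η k, by simp [bnorm, hη], (hη0 0).trans (hN 0), by simp; linarith, ?_⟩
      simp only [Real.rpow_one]
      exact weighted_sq_le_sup_bound hv hv0 hη0 hN
    · have hq : 2 ≤ p.toReal := by
        simpa using (ENNReal.toReal_le_toReal (by simp) hp').mpr hp
      have hs' := hξ.summable (by linarith)
      simp only [Real.norm_of_nonneg (hη0 _)] at hs'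
      refine ⟨1 - 2 / p.toReal, (∑' k, η k ^ p.toReal) ^ (1 / p.toReal), ?_,
        Real.rpow_nonneg (tsum_nonneg fun k => Real.rpow_nonneg (hη0 k) _) _, ?_,
        weighted_sq_le_rpow_sum hq hv hv0 hη0 hs'⟩
      · rw [bnorm, if_neg hp']
        congr 3
        ext k
        simp only [hη]
        split_ifs
        · rw [Real.zero_rpow (by linarith)]
        · rfl
      · have : 0 ≤ ε * (2 / p.toReal) := by positivity
        simp only [one_div, ENNReal.toReal_inv]
        ring_nf at this ⊢
        linarith
  have key : ∀ k, (jbr k ^ (s + (1 / p).toReal - 1 / 2 - ε / 2) * ‖ξ k‖) ^ 2 ≤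
      (if k = 0 then ‖ξ 0‖ ^ 2 else 0) +
        2 ^ (2 * s) * ((jbr k ^ (-(1 + ε))) ^ θ * η k ^ 2) := by
    intro k
    by_cases hk : k = 0
    · simp [hk, hη, jbr]
    have hJ := jbr_pos k
    have hk0 : (0 : ℝ) < |(k : ℝ)| := by positivity
    simp only [hη, hk, if_false, zero_add]
    have e1 : (jbr k ^ (s + (1 / p).toReal - 1 / 2 - ε / 2)) ^ 2 =
        jbr k ^ (2 * s) * jbr k ^ (2 * (1 / p).toReal - 1 - ε) := by
      rw [← Real.rpow_natCast, ← Real.rpow_mul hJ.le, ← Real.rpow_add hJ]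
      push_cast
      ring_nf
    have e2 : jbr k ^ (2 * s) ≤ 2 ^ (2 * s) * (|(k : ℝ)| ^ s) ^ 2 := by
      calc jbr k ^ (2 * s) ≤ (2 * |(k : ℝ)|) ^ (2 * s) :=
            Real.rpow_le_rpow hJ.le (jbr_le_two_mul_abs hk) (by linarith)
        _ = _ := by
          rw [Real.mul_rpow zero_le_two hk0.le, ← Real.rpow_natCast (|(k : ℝ)| ^ s),
            ← Real.rpow_mul hk0.le]
          push_cast
          ring_nf
    have e3 : jbr k ^ (2 * (1 / p).toReal - 1 - ε) ≤ (jbr k ^ (-(1 + ε))) ^ θ := by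
      rw [← Real.rpow_mul hJ.le]
      exact Real.rpow_le_rpow_of_exponent_le (one_le_jbr k) hθ
    rw [mul_pow, e1]
    calc _ ≤ 2 ^ (2 * s) * (|(k : ℝ)| ^ s) ^ 2 * (jbr k ^ (-(1 + ε))) ^ θ * ‖ξ k‖ ^ 2 := by
          gcongr
      _ = _ := by ring
  have hs0 := hasSum_ite_eq (0 : ℤ) (‖ξ 0‖ ^ 2)
  have hg := hs0.summable.add (hsum.mul_left (2 ^ (2 * s)))
  have hf := hg.of_nonneg_of_le (fun k => sq_nonneg _) key
  refine ⟨hf, (hf.tsum_le_tsum key hg).trans ?_⟩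
  rw [hs0.summable.tsum_add (hsum.mul_left _), hs0.tsum_eq, tsum_mul_left, hb]
  have h2 : (0 : ℝ) < 2 ^ (2 * s) := by positivity
  have h3 : ‖ξ 0‖ ^ 2 ≤ (‖ξ 0‖ + N) ^ 2 := by gcongr; linarith
  have h4 : N ^ 2 ≤ (‖ξ 0‖ + N) ^ 2 := by gcongr; linarith [norm_nonneg (ξ 0)]
  calc _ ≤ (‖ξ 0‖ + N) ^ 2 + 2 ^ (2 * s) * ((1 + V) * (‖ξ 0‖ + N) ^ 2) := by
        gcongr
        exact hle.trans (by gcongr)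
    _ = _ := by ring

lemma tsum_ofReal_sq {f : ℤ → ℝ} (hf : ∀ k, 0 ≤ f k) (hs : Summable fun k => f k ^ 2) :
    ∑' k, ENNReal.ofReal (f k) ^ 2 = ENNReal.ofReal (∑' k, f k ^ 2) := by
  rw [ENNReal.ofReal_tsum_of_nonneg (fun k => sq_nonneg _) hs]
  simp_rw [ENNReal.ofReal_pow (hf _)]

lemma summable_sq_norm_and_tsum_le {E : ℤ → ℂ} {B : ℝ} (hB : 0 ≤ B)
    (h : ∑' k, ‖E k‖ₑ ^ 2 ≤ ENNReal.ofReal B) :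
    Summable (fun k => ‖E k‖ ^ 2) ∧ ∑' k, ‖E k‖ ^ 2 ≤ B := by
  have e : ∀ k, ‖E k‖ₑ ^ 2 = ENNReal.ofReal (‖E k‖ ^ 2) := fun k => by
    rw [ENNReal.ofReal_pow (norm_nonneg _), ofReal_norm]
  have hs : Summable fun k => ‖E k‖ ^ 2 := by
    have h1 := ENNReal.summable_toReal (h.trans_lt ENNReal.ofReal_lt_top).ne
    refine h1.congr fun k => ?_
    rw [e, ENNReal.toReal_ofReal (sq_nonneg _)]
  refine ⟨hs, ?_⟩
  simp_rw [e] at h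
  rwa [← ENNReal.ofReal_tsum_of_nonneg (fun k => sq_nonneg _) hs,
    ENNReal.ofReal_le_ofReal_iff hB] at h

/-- Local error of the twisted potential approximation (Lemma 5.5, Fourier form):
for `s ≥ 0`, `2 ≤ p ≤ ∞`, `γ_p = 3/2 + 1/p`, `ε ∈ (0,1/4)`,
`a = min{s + 1/p + 1/4 − ε, 1}` and `σ = s + γ_p − ε`, there is `C > 0` such that for all
`τ ∈ (0,1]`, all `ξ̂ ∈ b̂^{s,p}` and `w ∈ h^σ`, the sequence
`E_k = Σ_{k₁+k₂=k} [M_τ(e^{is(k²−k₂²)}) − M_τ(e^{isk²}) M_τ(e^{−isk₂²})] ξ̂_{k₁} w_{k₂}`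
satisfies `‖E‖_{ℓ²} ≤ C τ^a ‖ξ̂‖_{b̂^{s,p}} ‖w‖_{h^σ}`. -/
theorem local_error_twisted_potential (s : ℝ) (hs : 0 ≤ s) (p : ℝ≥0∞) (hp : 2 ≤ p)
    (ε : ℝ) (hε0 : 0 < ε) (hε1 : ε < 1 / 4) :
    ∃ C > 0, ∀ τ : ℝ, 0 < τ → τ ≤ 1 →
      ∀ ξ : ℤ → ℂ, Memℓp (fun k : ℤ => if k = 0 then (0 : ℝ) else (|k| : ℝ) ^ s * ‖ξ k‖) p →
      ∀ w : ℤ → ℂ,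
        Summable (fun k : ℤ =>
          jbr k ^ (2 * (s + (3 / 2 + (1 / p).toReal) - ε)) * ‖w k‖ ^ 2) →
      ∀ E : ℤ → ℂ,
        (∀ k : ℤ, E k = ∑' k₁ : ℤ,
            (avgExp τ ((k : ℝ) ^ 2 - ((k - k₁ : ℤ) : ℝ) ^ 2) -
                avgExp τ ((k : ℝ) ^ 2) * avgExp τ (-(((k - k₁ : ℤ) : ℝ) ^ 2))) *
              ξ k₁ * w (k - k₁)) →
        Summable (fun k : ℤ => ‖E k‖ ^ 2) ∧
        (∑' k : ℤ, ‖E k‖ ^ 2) ^ ((1 : ℝ) / 2) ≤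
          C * τ ^ min (s + (1 / p).toReal + 1 / 4 - ε) 1 * bnorm s p ξ *
            (∑' k : ℤ,
              jbr k ^ (2 * (s + (3 / 2 + (1 / p).toReal) - ε)) * ‖w k‖ ^ 2) ^ ((1 : ℝ) / 2) := by
  obtain ⟨C₀, hC₀, hemb⟩ := exists_weighted_sq_le_bnorm_sq hs hp hε0
  have hμ2 : ∀ k : ℤ, (jbr k ^ (-(1 / 2 + ε / 2))) ^ 2 = jbr k ^ (-(1 + ε)) := fun k => by
    rw [← Real.rpow_natCast, ← Real.rpow_mul (jbr_pos k).le]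
    push_cast
    ring_nf
  have hμ0 : ∀ (k : ℤ) (b : ℝ), 0 ≤ jbr k ^ b := fun k b => Real.rpow_nonneg (jbr_pos k).le _
  have hμs : Summable fun k : ℤ => (jbr k ^ (-(1 / 2 + ε / 2))) ^ 2 := by
    simp_rw [hμ2]
    exact summable_jbr_rpow_neg (by linarith)
  set M := ∑' k : ℤ, (jbr k ^ (-(1 / 2 + ε / 2))) ^ 2 with hM
  have hM0 : 0 ≤ M := tsum_nonneg fun k => sq_nonneg _
  refine ⟨24 * √(M * C₀) + 1, by positivity, fun τ hτ _ ξ hξ w hw E hE => ?_⟩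
  set r := s + (1 / p).toReal with hr
  have hr0 : 0 ≤ r := add_nonneg hs ENNReal.toReal_nonneg
  have hw2 : ∀ k, jbr k ^ (2 * (s + (3 / 2 + (1 / p).toReal) - ε)) * ‖w k‖ ^ 2 =
      (jbr k ^ (r + 3 / 2 - ε) * ‖w k‖) ^ 2 := fun k => by
    rw [mul_pow, ← Real.rpow_natCast (jbr k ^ (r + 3 / 2 - ε)), ← Real.rpow_mul (jbr_pos k).le]
    push_cast
    rw [hr]
    ring_nf
  simp_rw [hw2] at hw ⊢
  obtain ⟨hX, hXle⟩ := hemb ξ hξ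
  set X := ∑' k, (jbr k ^ (r - 1 / 2 - ε / 2) * ‖ξ k‖) ^ 2
  set Y := ∑' k, (jbr k ^ (r + 3 / 2 - ε) * ‖w k‖) ^ 2
  have hX0 : 0 ≤ X := tsum_nonneg fun k => sq_nonneg _
  have hY0 : 0 ≤ Y := tsum_nonneg fun k => sq_nonneg _
  set a := min (r + 1 / 4 - ε) 1 with ha
  have hc : 0 ≤ 12 * τ ^ a := by positivity
  have hbound : ∀ k, ‖E k‖ₑ ≤ ENNReal.ofReal (12 * τ ^ a) *
      ∑' j, (ENNReal.ofReal (jbr j ^ (-(1 / 2 + ε / 2))) +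
        ENNReal.ofReal (jbr (k - j) ^ (-(1 / 2 + ε / 2)))) *
        ENNReal.ofReal (jbr j ^ (r - 1 / 2 - ε / 2) * ‖ξ j‖) *
        ENNReal.ofReal (jbr (k - j) ^ (r + 3 / 2 - ε) * ‖w (k - j)‖) := by
    intro k
    rw [hE, ← ENNReal.tsum_mul_left]
    refine enorm_tsum_le_tsum_enorm.trans (ENNReal.tsum_le_tsum fun j => ?_)
    rw [← ENNReal.ofReal_add (hμ0 _ _) (hμ0 _ _),
      ← ENNReal.ofReal_mul (add_nonneg (hμ0 _ _) (hμ0 _ _)),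
      ← ENNReal.ofReal_mul (mul_nonneg (add_nonneg (hμ0 _ _) (hμ0 _ _))
        (mul_nonneg (hμ0 _ _) (norm_nonneg _))), ← ENNReal.ofReal_mul hc, ← ofReal_norm]
    refine ENNReal.ofReal_le_ofReal ?_
    have hK := norm_avgCov_le_weights hτ hr0 hε0 hε1 k j
    rw [norm_mul, norm_mul]
    refine (mul_le_mul_of_nonneg_right (mul_le_mul_of_nonneg_right hK (norm_nonneg _))
      (norm_nonneg _)).trans_eq ?_
    ring
  have hsq : ∑' k, ‖E k‖ₑ ^ 2 ≤ ENNReal.ofReal ((12 * τ ^ a) ^ 2 * (4 * M * X * Y)) := by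
    have e : ENNReal.ofReal ((12 * τ ^ a) ^ 2 * (4 * M * X * Y)) =
        ENNReal.ofReal (12 * τ ^ a) ^ 2 *
          (4 * ENNReal.ofReal M * ENNReal.ofReal X * ENNReal.ofReal Y) := by
      rw [ENNReal.ofReal_mul (sq_nonneg _), ENNReal.ofReal_mul (p := 4 * M * X) (by positivity),
        ENNReal.ofReal_mul (p := 4 * M) (by positivity),
        ENNReal.ofReal_mul (p := 4) (by positivity), ENNReal.ofReal_pow hc, ENNReal.ofReal_ofNat]
    rw [e]
    refine (ENNReal.tsum_le_tsum fun k => pow_le_pow_left₀ bot_le (hbound k) 2).trans ?_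
    simp_rw [mul_pow]
    rw [ENNReal.tsum_mul_left]
    refine (mul_le_mul_right (ENNReal.tsum_weighted_conv_sq_le
      (fun j => ENNReal.ofReal (jbr j ^ (-(1 / 2 + ε / 2))))
      (fun j => ENNReal.ofReal (jbr j ^ (r - 1 / 2 - ε / 2) * ‖ξ j‖))
      (fun j => ENNReal.ofReal (jbr j ^ (r + 3 / 2 - ε) * ‖w j‖))) _).trans_eq ?_
    rw [tsum_ofReal_sq (fun k => hμ0 _ _) hμs,
      tsum_ofReal_sq (fun k => mul_nonneg (hμ0 _ _) (norm_nonneg _)) hX,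
      tsum_ofReal_sq (fun k => mul_nonneg (hμ0 _ _) (norm_nonneg _)) hw]
  obtain ⟨h1, h2⟩ := summable_sq_norm_and_tsum_le (by positivity) hsq
  refine ⟨h1, ?_⟩
  have hb0 : 0 ≤ bnorm s p ξ := by
    unfold bnorm
    refine add_nonneg (norm_nonneg _) ?_
    split_ifs
    · refine Real.iSup_nonneg fun k => ?_
      split_ifs <;> positivity
    · refine Real.rpow_nonneg (tsum_nonneg fun k => ?_) _
      split_ifs <;> positivity
  rw [← Real.sqrt_eq_rpow, ← Real.sqrt_eq_rpow]
  calc √(∑' k, ‖E k‖ ^ 2)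
      ≤ √((24 * τ ^ a * bnorm s p ξ) ^ 2 * (M * C₀ * Y)) := by
        refine Real.sqrt_le_sqrt (h2.trans ?_)
        calc (12 * τ ^ a) ^ 2 * (4 * M * X * Y)
            ≤ (12 * τ ^ a) ^ 2 * (4 * M * (C₀ * bnorm s p ξ ^ 2) * Y) := by gcongr
          _ = _ := by ring
    _ = 24 * √(M * C₀) * τ ^ a * bnorm s p ξ * √Y := by
        rw [Real.sqrt_mul (sq_nonneg _), Real.sqrt_sq (by positivity),
          Real.sqrt_mul (by positivity)]
        ring
    _ ≤ (24 * √(M * C₀) + 1) * τ ^ a * bnorm s p ξ * √Y := by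
        gcongr
        linarith
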